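/- Let D and D' be bounded domains in ℂ, let p > 2, and let f : D → D' be a Q-homeomorphism with respect to the p-modulus. Suppose that q_{z₀}(t) ≤ q₀ · t^{−α} for some q₀ ∈ (0,∞) and α ∈ [0,∞), for a point z₀ ∈ D and for almost every t ∈ (0, d₀), where d₀ = dist(z₀, ∂D). Then for all r ∈ (0, d₀), |f(B(z₀,r))| ≥ π^{−α/(p−2)} · ((p−2)/(α+p−2))^{2(p−1)/(p−2)} · q₀^{2/(2−p)} · |B(z₀,r)|^{1+α/(p−2)}. -/

import Mathlib

open MeasureTheory Set Metric Complex ENNReal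

noncomputable section

open Classical in
/-- The line integral `∫_γ ρ |dz|` of a Borel density `ρ` along a curve `γ`
(parametrized on `[0,1]`), with the convention that the integral is `∞`
for curves that are not rectifiable (here: not Lipschitz on `[0,1]`). -/
def lineIntegral (ρ : ℂ → ℝ≥0∞) (γ : ℝ → ℂ) : ℝ≥0∞ :=
  if ∃ K : NNReal, LipschitzOnWith K γ (Set.Icc 0 1) then
    ∫⁻ t in Set.Icc (0 : ℝ) 1, ρ (γ t) * (‖deriv γ t‖₊ : ℝ≥0∞)
  else ⊤

/-- A Borel function `ρ : ℂ → [0,∞]` is admissible for the curve family `Γ`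
if `∫_γ ρ |dz| ≥ 1` for every `γ ∈ Γ`. -/
def IsAdmissible (ρ : ℂ → ℝ≥0∞) (Γ : Set (ℝ → ℂ)) : Prop :=
  Measurable ρ ∧ ∀ γ ∈ Γ, 1 ≤ lineIntegral ρ γ

/-- The `p`-modulus of a family `Γ` of curves in `ℂ`:
`M_p(Γ) = inf { ∫_ℂ ρ^p dm : ρ admissible for Γ }`. -/
def pModulus (p : ℝ) (Γ : Set (ℝ → ℂ)) : ℝ≥0∞ :=
  ⨅ (ρ : ℂ → ℝ≥0∞) (_ : IsAdmissible ρ Γ), ∫⁻ z : ℂ, ρ z ^ p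

/-- `Γ` is a family of curves lying in the set `D`. -/
def CurveFamilyIn (Γ : Set (ℝ → ℂ)) (D : Set ℂ) : Prop :=
  ∀ γ ∈ Γ, ContinuousOn γ (Set.Icc 0 1) ∧ ∀ t ∈ Set.Icc (0 : ℝ) 1, γ t ∈ D

/-- `f` is a homeomorphism of `D` onto its image: continuous, injective and open on `D`. -/
def IsHomeoOn (f : ℂ → ℂ) (D : Set ℂ) : Prop :=
  ContinuousOn f D ∧ Set.InjOn f D ∧ ∀ U ⊆ D, IsOpen U → IsOpen (f '' U)

/-- `f` is a `Q`-homeomorphism with respect to the `p`-modulus on `D`: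
`M_p(fΓ) ≤ ∫_D Q(z) ρ(z)^p dm(z)` for every curve family `Γ` in `D` and every
`ρ` admissible for `Γ`. -/
def IsQHomeo (p : ℝ) (D : Set ℂ) (Q : ℂ → ℝ≥0∞) (f : ℂ → ℂ) : Prop :=
  IsHomeoOn f D ∧
    ∀ Γ : Set (ℝ → ℂ), CurveFamilyIn Γ D → ∀ ρ : ℂ → ℝ≥0∞, IsAdmissible ρ Γ →
      pModulus p ((fun γ => f ∘ γ) '' Γ) ≤ ∫⁻ z in D, Q z * ρ z ^ p

/-- The integral mean `q_{z₀}(r) = (1/(2πr)) ∫_{S(z₀,r)} Q(z) |dz|` of `Q` over the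
circle `S(z₀,r)`, computed via the arclength parametrization `θ ↦ z₀ + r e^{iθ}`. -/
def circleMean (Q : ℂ → ℝ≥0∞) (z₀ : ℂ) (r : ℝ) : ℝ≥0∞ :=
  (∫⁻ θ in Set.Icc (0 : ℝ) (2 * Real.pi),
      Q (z₀ + (r : ℂ) * Complex.exp ((θ : ℂ) * Complex.I))) / ENNReal.ofReal (2 * Real.pi)

lemma lintegral_Ioo_neg_pi_pi_eq_Icc {F : ℝ → ℝ≥0∞} (hF : Function.Periodic F (2 * Real.pi)) :
    ∫⁻ θ in Ioo (-Real.pi) Real.pi, F θ = ∫⁻ θ in Icc 0 (2 * Real.pi), F θ := by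
  have h2 : (0 : ℝ) < 2 * Real.pi := by positivity
  have key := (isAddFundamentalDomain_Ioc h2 (-Real.pi)).setLIntegral_eq
    (isAddFundamentalDomain_Ioc h2 0) F (fun g x => by
      obtain ⟨g, hg⟩ := g
      obtain ⟨n, rfl⟩ := AddSubgroup.mem_zmultiples_iff.1 hg
      simpa [AddSubgroup.vadd_def, add_comm] using hF.zsmul n x)
  rw [show -Real.pi + 2 * Real.pi = Real.pi by ring, zero_add] at key
  rw [setLIntegral_congr Ioo_ae_eq_Ioc, key, setLIntegral_congr Ioc_ae_eq_Icc]

lemma measurable_polar_map (z₀ : ℂ) :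
    Measurable fun x : ℝ × ℝ => z₀ + (x.1 : ℂ) * Complex.exp ((x.2 : ℂ) * Complex.I) := by
  fun_prop

lemma lintegral_eq_lintegral_polar {F : ℂ → ℝ≥0∞} (hF : Measurable F) (z₀ : ℂ) :
    ∫⁻ z, F z = ∫⁻ t in Ioi (0 : ℝ), ∫⁻ θ in Ioo (-Real.pi) Real.pi,
      ENNReal.ofReal t * F (z₀ + (t : ℂ) * Complex.exp ((θ : ℂ) * Complex.I)) := by
  have hm := hF.comp (measurable_polar_map z₀)
  rw [← lintegral_add_left_eq_self F z₀, ← Complex.lintegral_comp_polarCoord_symm,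
    polarCoord_target, Measure.volume_eq_prod]
  have : ∀ x : ℝ × ℝ, ENNReal.ofReal x.1 • F (z₀ + Complex.polarCoord.symm x) =
      ENNReal.ofReal x.1 * F (z₀ + (x.1 : ℂ) * Complex.exp ((x.2 : ℂ) * Complex.I)) := by
    intro x
    rw [Complex.polarCoord_symm_apply, Complex.exp_mul_I, smul_eq_mul]
    simp
  simp_rw [this]
  rw [setLIntegral_prod]
  exact (Measurable.mul (by fun_prop) hm).aemeasurable

lemma lintegral_eq_lintegral_polar_swap {F : ℂ → ℝ≥0∞} (hF : Measurable F) (z₀ : ℂ) :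
    ∫⁻ z, F z = ∫⁻ θ in Ioo (-Real.pi) Real.pi, ∫⁻ t in Ioi (0 : ℝ),
      ENNReal.ofReal t * F (z₀ + (t : ℂ) * Complex.exp ((θ : ℂ) * Complex.I)) := by
  rw [lintegral_eq_lintegral_polar hF z₀, lintegral_lintegral_swap]
  exact (Measurable.mul (by fun_prop) (hF.comp (measurable_polar_map z₀))).aemeasurable

lemma lintegral_eq_lintegral_circleMean {F : ℂ → ℝ≥0∞} (hF : Measurable F) (z₀ : ℂ) :
    ∫⁻ z, F z = ∫⁻ t in Ioi (0 : ℝ),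
      ENNReal.ofReal (2 * Real.pi * t) * circleMean F z₀ t := by
  rw [lintegral_eq_lintegral_polar hF z₀]
  refine setLIntegral_congr_fun measurableSet_Ioi fun t ht => ?_
  have h2 : ENNReal.ofReal (2 * Real.pi) ≠ 0 := by
    simp [Real.pi_pos]
  rw [lintegral_const_mul' _ _ (by simp), lintegral_Ioo_neg_pi_pi_eq_Icc, circleMean,
    ENNReal.ofReal_mul (by positivity), mul_comm (ENNReal.ofReal (2 * Real.pi)), mul_assoc,
    ENNReal.mul_div_cancel h2 ENNReal.ofReal_ne_top]
  intro θ
  have : ((θ + 2 * Real.pi : ℝ) : ℂ) * Complex.I = θ * Complex.I + 2 * Real.pi * Complex.I := by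
    push_cast; ring
  simp only [this, Complex.exp_periodic _]

lemma lintegral_Ioo_rpow {β L : ℝ} (hβ : -1 < β) (hL : 0 ≤ L) :
    ∫⁻ s in Ioo 0 L, ENNReal.ofReal s ^ β = ENNReal.ofReal (L ^ (β + 1) / (β + 1)) := by
  have h1 : ∫⁻ s in Ioo 0 L, ENNReal.ofReal s ^ β = ∫⁻ s in Ioo 0 L, ENNReal.ofReal (s ^ β) :=
    setLIntegral_congr_fun measurableSet_Ioo fun s hs => ENNReal.ofReal_rpow_of_pos hs.1
  have hint : IntervalIntegrable (fun s : ℝ => s ^ β) volume 0 L :=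
    intervalIntegral.intervalIntegrable_rpow' hβ
  rw [h1, ← ofReal_integral_eq_lintegral_ofReal]
  · rw [← integral_Ioc_eq_integral_Ioo, ← intervalIntegral.integral_of_le hL,
      integral_rpow (Or.inl hβ), Real.zero_rpow (by linarith), sub_zero]
  · exact ((intervalIntegrable_iff_integrableOn_Ioc_of_le hL).1 hint).mono_set Ioo_subset_Ioc_self
  · filter_upwards [ae_restrict_mem measurableSet_Ioo] with s hs
    exact Real.rpow_nonneg hs.1.le _

lemma measure_univ_rpow_le_of_one_le {X : Type*} [MeasurableSpace X] {μ : Measure X}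
    {k : ℝ} (hk : 0 < k) {F G : X → ℝ≥0∞} (hF : AEMeasurable F μ) (hG : AEMeasurable G μ)
    (h : ∀ᵐ x ∂μ, 1 ≤ F x * G x ^ k) :
    μ univ ^ (k + 1) ≤ (∫⁻ x, F x ∂μ) * (∫⁻ x, G x ∂μ) ^ k := by
  have hk1 : 0 < k + 1 := by linarith
  have hc : (k + 1).HolderConjugate ((k + 1) / k) := by
    rw [Real.holderConjugate_iff]
    refine ⟨by linarith, ?_⟩
    field_simp
    ring
  have hH := ENNReal.lintegral_mul_le_Lp_mul_Lq μ hc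
    (hF.pow_const (1 / (k + 1))) (hG.pow_const (k / (k + 1)))
  simp only [← ENNReal.rpow_mul, Pi.mul_apply] at hH
  rw [show 1 / (k + 1) * (k + 1) = 1 by field_simp,
    show k / (k + 1) * ((k + 1) / k) = 1 by field_simp] at hH
  simp only [ENNReal.rpow_one] at hH
  have h1 : μ univ ≤ ∫⁻ x, F x ^ (1 / (k + 1)) * G x ^ (k / (k + 1)) ∂μ := by
    rw [← lintegral_one]
    refine lintegral_mono_ae ?_
    filter_upwards [h] with x hx
    have := ENNReal.rpow_le_rpow hx (z := 1 / (k + 1)) (by positivity)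
    rwa [ENNReal.one_rpow, ENNReal.mul_rpow_of_nonneg _ _ (by positivity), ← ENNReal.rpow_mul,
      mul_one_div] at this
  have := ENNReal.rpow_le_rpow (h1.trans hH) hk1.le
  rwa [ENNReal.mul_rpow_of_nonneg _ _ hk1.le, ← ENNReal.rpow_mul, ← ENNReal.rpow_mul,
    show 1 / (k + 1) * (k + 1) = 1 by field_simp,
    show 1 / ((k + 1) / k) * (k + 1) = k by field_simp, ENNReal.rpow_one] at this

lemma one_le_mul_lintegral_weighted_rpow {p : ℝ} (hp : 2 < p) {L : ℝ} (hL : 0 < L) {h : ℝ → ℝ≥0∞}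
    (hm : Measurable h) (h1 : 1 ≤ ∫⁻ s in Ioo 0 L, h s) :
    1 ≤ ENNReal.ofReal (((p - 1) / (p - 2)) ^ (p - 1)) *
      (∫⁻ s in Ioo 0 L, ENNReal.ofReal s * h s ^ p) * ENNReal.ofReal L ^ (p - 2) := by
  have hp0 : 0 < p := by linarith
  have hp1 : 0 < p - 1 := by linarith
  have hp2 : 0 < p - 2 := by linarith
  have hc : p.HolderConjugate (p / (p - 1)) := by
    rw [Real.holderConjugate_iff]
    refine ⟨by linarith, ?_⟩
    field_simp
    ring
  have hH := ENNReal.lintegral_mul_le_Lp_mul_Lq (volume.restrict (Ioo 0 L)) hc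
    (f := fun s => ENNReal.ofReal s ^ (1 / p) * h s) (g := fun s => ENNReal.ofReal s ^ (-(1 / p)))
    (by fun_prop) (by fun_prop)
  have e1 : ∫⁻ s in Ioo 0 L, ((fun s => ENNReal.ofReal s ^ (1 / p) * h s) *
      fun s => ENNReal.ofReal s ^ (-(1 / p))) s = ∫⁻ s in Ioo 0 L, h s := by
    refine setLIntegral_congr_fun measurableSet_Ioo fun s hs => ?_
    have h0 : ENNReal.ofReal s ≠ 0 := by simpa using hs.1
    simp only [Pi.mul_apply]
    rw [mul_right_comm, ← ENNReal.rpow_add _ _ h0 (by simp), add_neg_cancel, ENNReal.rpow_zero,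
      one_mul]
  have e2 : ∫⁻ s in Ioo 0 L, (ENNReal.ofReal s ^ (1 / p) * h s) ^ p =
      ∫⁻ s in Ioo 0 L, ENNReal.ofReal s * h s ^ p := by
    refine lintegral_congr fun s => ?_
    rw [ENNReal.mul_rpow_of_nonneg _ _ hp0.le, ← ENNReal.rpow_mul,
      show 1 / p * p = 1 by field_simp, ENNReal.rpow_one]
  have e3 : ∫⁻ s in Ioo 0 L, (ENNReal.ofReal s ^ (-(1 / p))) ^ (p / (p - 1)) =
      ENNReal.ofReal ((p - 1) / (p - 2) * L ^ ((p - 2) / (p - 1))) := by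
    simp only [← ENNReal.rpow_mul]
    rw [show -(1 / p) * (p / (p - 1)) = -(1 / (p - 1)) by field_simp, lintegral_Ioo_rpow _ hL.le]
    · rw [show -(1 / (p - 1)) + 1 = (p - 2) / (p - 1) by field_simp; ring]
      congr 1
      field_simp
    · rw [neg_lt_neg_iff, div_lt_one hp1]
      linarith
  rw [e1, e2, e3] at hH
  have := ENNReal.rpow_le_rpow (h1.trans hH) hp0.le
  rw [ENNReal.one_rpow, ENNReal.mul_rpow_of_nonneg _ _ hp0.le, ← ENNReal.rpow_mul,
    ← ENNReal.rpow_mul, show 1 / p * p = 1 by field_simp,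
    show 1 / (p / (p - 1)) * p = p - 1 by field_simp, ENNReal.rpow_one,
    ENNReal.ofReal_mul (by positivity), ENNReal.mul_rpow_of_nonneg _ _ hp1.le,
    ENNReal.ofReal_rpow_of_pos (by positivity), ENNReal.ofReal_rpow_of_pos (by positivity),
    ← Real.rpow_mul hL.le, div_mul_cancel₀ _ hp1.ne'] at this
  rw [ENNReal.ofReal_rpow_of_pos hL]
  calc _ ≤ _ := this
    _ = _ := by ring

lemma exists_exit_radius {G : Set ℂ} (hGo : IsOpen G) (hGb : Bornology.IsBounded G) {w₀ e : ℂ}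
    (hw : w₀ ∈ G) (he : ‖e‖ = 1) :
    ∃ L : ℝ, 0 < L ∧ (∀ s ∈ Ico 0 L, w₀ + (s : ℂ) * e ∈ G) ∧ w₀ + (L : ℂ) * e ∉ G := by
  set S : Set ℝ := {t | 0 ≤ t ∧ w₀ + (t : ℂ) * e ∉ G} with hS
  have hScl : IsClosed S := by
    have : S = Ici 0 ∩ (fun t : ℝ => w₀ + (t : ℂ) * e) ⁻¹' Gᶜ := rfl
    rw [this]
    exact isClosed_Ici.inter (hGo.isClosed_compl.preimage (by fun_prop))
  have hSne : S.Nonempty := by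
    obtain ⟨R, hR⟩ := hGb.subset_closedBall w₀
    refine ⟨|R| + 1, by positivity, fun hmem => ?_⟩
    have := hR hmem
    rw [mem_closedBall, dist_eq_norm, add_sub_cancel_left, norm_mul, he, mul_one,
      Complex.norm_real, Real.norm_of_nonneg (by positivity)] at this
    linarith [le_abs_self R]
  have hSb : BddBelow S := ⟨0, fun t ht => ht.1⟩
  have hmem := hScl.csInf_mem hSne hSb
  refine ⟨sInf S, lt_of_le_of_ne hmem.1 fun h0 => hmem.2 ?_, fun s hs => ?_, hmem.2⟩
  · rw [← h0]
    simpa using hw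
  · by_contra hcon
    exact absurd (csInf_le hSb ⟨hs.1, hcon⟩) (not_le.2 hs.2)

lemma rpow_two_pi_le_lintegral_mul_volume {p : ℝ} (hp : 2 < p) {G : Set ℂ} (hGo : IsOpen G)
    (hGb : Bornology.IsBounded G) {w₀ : ℂ} (hw : w₀ ∈ G) {ρ : ℂ → ℝ≥0∞} (hρ : Measurable ρ)
    (h : ∀ e : ℂ, ‖e‖ = 1 → ∀ L : ℝ, 0 < L → (∀ s ∈ Ico 0 L, w₀ + (s : ℂ) * e ∈ G) →
      w₀ + (L : ℂ) * e ∉ G → 1 ≤ ∫⁻ s in Ioo 0 L, ρ (w₀ + (s : ℂ) * e)) :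
    ENNReal.ofReal (2 * Real.pi) ^ (p / 2) ≤
      ENNReal.ofReal (((p - 1) / (p - 2)) ^ (p - 1)) * (∫⁻ z, ρ z ^ p) *
        (2 * volume G) ^ ((p - 2) / 2) := by
  have hp2 : 0 < p - 2 := by linarith
  set C := ENNReal.ofReal (((p - 1) / (p - 2)) ^ (p - 1)) with hC
  have hmap : Measurable fun x : ℝ × ℝ => w₀ + (x.2 : ℂ) * Complex.exp ((x.1 : ℂ) * Complex.I) :=
    (measurable_polar_map w₀).comp measurable_swap
  have hρp : Measurable fun z => ρ z ^ p := hρ.pow_const p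
  have hind : Measurable (G.indicator (1 : ℂ → ℝ≥0∞)) :=
    measurable_one.indicator hGo.measurableSet
  set R : ℝ → ℝ≥0∞ := fun θ => ∫⁻ t in Ioi (0 : ℝ),
      ENNReal.ofReal t * ρ (w₀ + (t : ℂ) * Complex.exp ((θ : ℂ) * Complex.I)) ^ p with hR
  set A : ℝ → ℝ≥0∞ := fun θ => ∫⁻ t in Ioi (0 : ℝ),
      ENNReal.ofReal t * G.indicator (1 : ℂ → ℝ≥0∞)
        (w₀ + (t : ℂ) * Complex.exp ((θ : ℂ) * Complex.I)) with hA
  have hRm : Measurable R :=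
    Measurable.lintegral_prod_right (Measurable.mul (by fun_prop) (hρp.comp hmap))
  have hAm : Measurable A :=
    Measurable.lintegral_prod_right (Measurable.mul (by fun_prop) (hind.comp hmap))
  have hRi : ∫⁻ z, ρ z ^ p = ∫⁻ θ in Ioo (-Real.pi) Real.pi, R θ :=
    lintegral_eq_lintegral_polar_swap hρp w₀
  have hAi : volume G = ∫⁻ θ in Ioo (-Real.pi) Real.pi, A θ := by
    rw [← lintegral_indicator_one hGo.measurableSet]
    exact lintegral_eq_lintegral_polar_swap hind w₀
  have key := measure_univ_rpow_le_of_one_le (μ := volume.restrict (Ioo (-Real.pi) Real.pi))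
    (k := (p - 2) / 2) (by positivity) (F := fun θ => C * R θ) (G := fun θ => 2 * A θ)
    (hRm.const_mul C).aemeasurable (hAm.const_mul 2).aemeasurable (Filter.Eventually.of_forall ?_)
  · rw [lintegral_const_mul _ hRm, lintegral_const_mul _ hAm, ← hRi, ← hAi] at key
    rw [Measure.restrict_apply_univ, Real.volume_Ioo] at key
    convert key using 2
    · congr 1; ring
    · ring
  intro θ
  obtain ⟨L, hL, hin, hout⟩ := exists_exit_radius hGo hGb hw (Complex.norm_exp_ofReal_mul_I θ)
  have hm1 : Measurable fun s : ℝ => ρ (w₀ + (s : ℂ) * Complex.exp ((θ : ℂ) * Complex.I)) :=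
    hρ.comp (by fun_prop)
  refine (one_le_mul_lintegral_weighted_rpow hp hL hm1
    (h _ (Complex.norm_exp_ofReal_mul_I θ) L hL hin hout)).trans ?_
  have hLA : ENNReal.ofReal L ^ (2 : ℝ) ≤ 2 * A θ := by
    have : ∫⁻ s in Ioo 0 L, ENNReal.ofReal s ^ (1 : ℝ) ≤ A θ := by
      rw [hA]
      refine le_trans ?_ (lintegral_mono_set (Ioo_subset_Ioi_self : Ioo 0 L ⊆ Ioi 0))
      refine (setLIntegral_congr_fun measurableSet_Ioo fun s hs => ?_).le
      rw [indicator_of_mem (hin s ⟨hs.1.le, hs.2⟩), ENNReal.rpow_one]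
      simp
    rw [lintegral_Ioo_rpow (by norm_num) hL.le] at this
    calc _ = 2 * ENNReal.ofReal (L ^ ((1 : ℝ) + 1) / (1 + 1)) := by
          rw [← ENNReal.ofReal_ofNat 2, ← ENNReal.ofReal_mul (by norm_num),
            ENNReal.ofReal_rpow_of_pos hL]
          congr 1
          norm_num
          ring
      _ ≤ _ := by gcongr
  have h3 := ENNReal.rpow_le_rpow hLA (z := (p - 2) / 2) (by positivity)
  rw [← ENNReal.rpow_mul, mul_div_cancel₀ _ (two_ne_zero)] at h3
  refine mul_le_mul' (mul_le_mul_right ?_ C) h3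
  exact lintegral_mono_set Ioo_subset_Ioi_self

/-- The continuous curves in the closed disc `B(z₀, r)` joining the centre to the circle. -/
def radialCurves (z₀ : ℂ) (r : ℝ) : Set (ℝ → ℂ) :=
  {γ | ContinuousOn γ (Icc 0 1) ∧ (∀ t ∈ Icc (0 : ℝ) 1, γ t ∈ closedBall z₀ r) ∧
    γ 0 = z₀ ∧ dist (γ 1) z₀ = r}

lemma IsHomeoOn.continuousOn_invFunOn {f : ℂ → ℂ} {D : Set ℂ} (hf : IsHomeoOn f D)
    (hD : IsOpen D) : ContinuousOn (Function.invFunOn f D) (f '' D) := by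
  obtain ⟨-, hinj, hopen⟩ := hf
  have hleft := hinj.leftInvOn_invFunOn
  rintro _ ⟨x, hx, rfl⟩
  refine ContinuousAt.continuousWithinAt ?_
  rw [ContinuousAt, hleft hx, Filter.tendsto_def]
  intro U hU
  obtain ⟨V, hVU, hV, hxV⟩ := _root_.mem_nhds_iff.1 (Filter.inter_mem hU (hD.mem_nhds hx))
  refine Filter.mem_of_superset
    ((hopen V (fun y hy => (hVU hy).2) hV).mem_nhds (mem_image_of_mem f hxV)) ?_
  rintro _ ⟨y, hy, rfl⟩
  rw [mem_preimage, hleft (hVU hy).2]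
  exact (hVU hy).1

lemma lineIntegral_of_eqOn_segment {ρ : ℂ → ℝ≥0∞} {g : ℝ → ℂ} {w e : ℂ} (he : ‖e‖ = 1) {L : ℝ}
    (hL : 0 < L) (hg : ∀ t ∈ Icc (0 : ℝ) 1, g t = w + ((t * L : ℝ) : ℂ) * e) :
    lineIntegral ρ g = ∫⁻ s in Ioo 0 L, ρ (w + (s : ℂ) * e) := by
  have hLip : ∃ K : NNReal, LipschitzOnWith K g (Icc 0 1) := by
    refine ⟨L.toNNReal, LipschitzOnWith.of_dist_le_mul fun x hx y hy => le_of_eq ?_⟩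
    rw [hg x hx, hg y hy, dist_add_left, dist_eq_norm, ← sub_mul, norm_mul, he, mul_one,
      ← Complex.ofReal_sub, Complex.norm_real, ← sub_mul, norm_mul, Real.norm_of_nonneg hL.le,
      Real.coe_toNNReal _ hL.le, Real.dist_eq, Real.norm_eq_abs, mul_comm]
  have himg : (fun t : ℝ => t * L) '' Ioo 0 1 = Ioo 0 L := by
    rw [image_mul_right_Ioo _ _ hL]
    simp
  rw [lineIntegral, if_pos hLip, setLIntegral_congr Ioo_ae_eq_Icc.symm, ← himg,
    lintegral_image_eq_lintegral_abs_deriv_mul measurableSet_Ioo (f' := fun _ => L)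
      (fun x _ => by simpa using ((hasDerivAt_id x).mul_const L).hasDerivWithinAt)
      (mul_left_injective₀ hL.ne').injOn]
  refine setLIntegral_congr_fun measurableSet_Ioo fun t ht => ?_
  have hd : HasDerivAt g ((L : ℂ) * e) t := by
    have h1 : HasDerivAt (fun t : ℝ => w + ((t * L : ℝ) : ℂ) * e) ((L : ℂ) * e) t := by
      have := (((hasDerivAt_id t).mul_const L).ofReal_comp.mul_const e).const_add w
      simpa using this
    refine h1.congr_of_eventuallyEq ?_
    filter_upwards [Icc_mem_nhds ht.1 ht.2] with s hs using hg s hs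
  rw [hd.deriv, hg t ⟨ht.1.le, ht.2.le⟩, mul_comm]
  congr 1
  rw [← enorm_eq_nnnorm, ← ofReal_norm, norm_mul, he, Complex.norm_real, mul_one,
    Real.norm_eq_abs]

lemma one_le_lintegral_ray_of_isAdmissible {f : ℂ → ℂ} {D : Set ℂ} (hf : IsHomeoOn f D)
    (hD : IsOpen D) {z₀ : ℂ} {r : ℝ} (hr : 0 < r) (hB : closedBall z₀ r ⊆ D) {ρ : ℂ → ℝ≥0∞}
    (hρ : IsAdmissible ρ ((fun γ => f ∘ γ) '' radialCurves z₀ r)) {e : ℂ} (he : ‖e‖ = 1) {L : ℝ}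
    (hL : 0 < L) (hin : ∀ s ∈ Ico 0 L, f z₀ + (s : ℂ) * e ∈ f '' ball z₀ r)
    (hout : f z₀ + (L : ℂ) * e ∉ f '' ball z₀ r) :
    1 ≤ ∫⁻ s in Ioo 0 L, ρ (f z₀ + (s : ℂ) * e) := by
  have hz : z₀ ∈ closedBall z₀ r := mem_closedBall_self hr.le
  have hcomp : IsCompact (f '' closedBall z₀ r) :=
    (isCompact_closedBall z₀ r).image_of_continuousOn (hf.1.mono hB)
  have hcl : closure (f '' ball z₀ r) ⊆ f '' closedBall z₀ r :=
    closure_minimal (image_mono ball_subset_closedBall) hcomp.isClosed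
  have hleft := hf.2.1.leftInvOn_invFunOn
  have hmem : ∀ s ∈ Icc 0 L, f z₀ + (s : ℂ) * e ∈ f '' closedBall z₀ r := by
    intro s hs
    rw [← closure_Ico hL.ne] at hs
    exact hcl (map_mem_closure (f := fun s : ℝ => f z₀ + (s : ℂ) * e) (by fun_prop) hs hin)
  have hmem' : ∀ t ∈ Icc (0 : ℝ) 1, f z₀ + ((t * L : ℝ) : ℂ) * e ∈ f '' closedBall z₀ r :=
    fun t ht => hmem _ ⟨mul_nonneg ht.1 hL.le, mul_le_of_le_one_left hL.le ht.2⟩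
  set γ : ℝ → ℂ := fun t => Function.invFunOn f D (f z₀ + ((t * L : ℝ) : ℂ) * e) with hγ
  have hfγ : ∀ t ∈ Icc (0 : ℝ) 1, (f ∘ γ) t = f z₀ + ((t * L : ℝ) : ℂ) * e := by
    intro t ht
    exact Function.invFunOn_eq ((image_mono hB) (hmem' t ht))
  have hγB : ∀ t ∈ Icc (0 : ℝ) 1, γ t ∈ closedBall z₀ r := by
    intro t ht
    obtain ⟨x, hx, hfx⟩ := hmem' t ht
    simp only [hγ]
    rw [← hfx, hleft (hB hx)]
    exact hx
  have hγmem : γ ∈ radialCurves z₀ r := by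
    refine ⟨?_, hγB, ?_, ?_⟩
    · refine (hf.continuousOn_invFunOn hD).comp (Continuous.continuousOn (by fun_prop)) ?_
      exact fun t ht => (image_mono hB) (hmem' t ht)
    · simp [hγ, hleft (hB hz)]
    · have h1 := hγB 1 (by simp)
      refine le_antisymm h1 (not_lt.1 fun hlt => hout ⟨γ 1, hlt, ?_⟩)
      simpa using hfγ 1 (by simp)
  have := hρ.2 _ (mem_image_of_mem _ hγmem)
  rwa [lineIntegral_of_eqOn_segment he hL hfγ] at this

lemma rpow_two_pi_le_pModulus_mul_volume {p : ℝ} (hp : 2 < p) {f : ℂ → ℂ} {D : Set ℂ}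
    (hf : IsHomeoOn f D) (hD : IsOpen D) {z₀ : ℂ} {r : ℝ} (hr : 0 < r)
    (hB : closedBall z₀ r ⊆ D) :
    ENNReal.ofReal (2 * Real.pi) ^ (p / 2) ≤
      ENNReal.ofReal (((p - 1) / (p - 2)) ^ (p - 1)) *
        pModulus p ((fun γ => f ∘ γ) '' radialCurves z₀ r) *
        (2 * volume (f '' ball z₀ r)) ^ ((p - 2) / 2) := by
  have hball : ball z₀ r ⊆ D := ball_subset_closedBall.trans hB
  have hGb : Bornology.IsBounded (f '' ball z₀ r) :=
    ((isCompact_closedBall z₀ r).image_of_continuousOn (hf.1.mono hB)).isBounded.subset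
      (image_mono ball_subset_closedBall)
  have hGo : IsOpen (f '' ball z₀ r) := hf.2.2 _ hball isOpen_ball
  have hw : f z₀ ∈ f '' ball z₀ r := mem_image_of_mem f (mem_ball_self hr)
  have hV : (2 * volume (f '' ball z₀ r)) ^ ((p - 2) / 2) ≠ ⊤ :=
    ENNReal.rpow_ne_top_of_nonneg (by linarith)
      (ENNReal.mul_ne_top (by simp) hGb.measure_lt_top.ne)
  have hV0 : (2 * volume (f '' ball z₀ r)) ^ ((p - 2) / 2) ≠ 0 := by
    have hpos := hGo.measure_pos volume ⟨_, hw⟩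
    refine (ENNReal.rpow_pos (ENNReal.mul_pos (by simp) hpos.ne') ?_).ne'
    exact ENNReal.mul_ne_top (by simp) hGb.measure_lt_top.ne
  have hC0 : ENNReal.ofReal (((p - 1) / (p - 2)) ^ (p - 1)) ≠ 0 := by
    have h1 : 0 < p - 1 := by linarith
    have h2 : 0 < p - 2 := by linarith
    exact (ENNReal.ofReal_pos.2 (by positivity)).ne'
  have hCV0 := mul_ne_zero hC0 hV0
  have hCV := ENNReal.mul_ne_top
    (ENNReal.ofReal_ne_top (r := ((p - 1) / (p - 2)) ^ (p - 1))) hV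
  rw [mul_right_comm, pModulus, ENNReal.mul_iInf_of_ne hCV0 hCV]
  refine le_iInf fun ρ => ?_
  rw [ENNReal.mul_iInf_of_ne hCV0 hCV]
  refine le_iInf fun hρ => ?_
  rw [mul_right_comm]
  exact rpow_two_pi_le_lintegral_mul_volume hp hGo hGb hw hρ.1
    fun e he L hL hin hout => one_le_lintegral_ray_of_isAdmissible hf hD hr hB hρ he hL hin hout

lemma norm_deriv_le_of_dist_le {u : ℝ → ℝ} {γ : ℝ → ℂ} {t : ℝ}
    (h : ∀ s, dist (u s) (u t) ≤ dist (γ s) (γ t)) (hγ : DifferentiableAt ℝ γ t) :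
    ‖deriv u t‖ ≤ ‖deriv γ t‖ := by
  by_cases hu : DifferentiableAt ℝ u t
  · have h1 := hu.hasDerivAt.tendsto_slope.norm
    have h2 := hγ.hasDerivAt.tendsto_slope.norm
    refine le_of_tendsto_of_tendsto h1 h2 (Filter.Eventually.of_forall fun s => ?_)
    simp only [slope, vsub_eq_sub, norm_smul]
    have := h s
    rw [dist_eq_norm, dist_eq_norm] at this
    gcongr
  · rw [deriv_zero_of_not_differentiableAt hu, norm_zero]
    exact norm_nonneg _

lemma ofReal_sub_le_lintegral_rpow {β : ℝ} (hβ : -1 < β) {z₀ : ℂ} {r ε : ℝ} (hε : 0 < ε)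
    (hεr : ε < r) {γ : ℝ → ℂ} {K : NNReal} (hγ : LipschitzOnWith K γ (Icc 0 1))
    (hB : ∀ t ∈ Icc (0 : ℝ) 1, γ t ∈ closedBall z₀ r) (h0 : γ 0 = z₀) (h1 : dist (γ 1) z₀ = r) :
    ENNReal.ofReal (r ^ (β + 1) / (β + 1) - ε ^ (β + 1) / (β + 1)) ≤
      ∫⁻ t in Icc (0 : ℝ) 1, ENNReal.ofReal (dist (γ t) z₀) ^ β * ‖deriv γ t‖ₑ := by
  have hβ1 : 0 < β + 1 := by linarith
  set u : ℝ → ℝ := fun t => max ε (dist (γ t) z₀) with hu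
  set φ : ℝ → ℝ := fun x => x ^ (β + 1) / (β + 1) with hφ
  have hdu : ∀ s t, dist (u s) (u t) ≤ dist (γ s) (γ t) := by
    intro s t
    rw [Real.dist_eq]
    refine (abs_max_sub_max_le_max _ _ _ _).trans ?_
    rw [sub_self, abs_zero, max_eq_right (abs_nonneg _)]
    exact abs_dist_sub_le _ _ _
  have huI : ∀ t ∈ Icc (0 : ℝ) 1, u t ∈ Icc ε r :=
    fun t ht => ⟨le_max_left _ _, max_le hεr.le (hB t ht)⟩
  have huL : LipschitzOnWith K u (Icc 0 1) :=
    LipschitzOnWith.of_dist_le_mul fun x hx y hy => (hdu x y).trans (hγ.dist_le_mul x hx y hy)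
  have hφd : ∀ x, 0 < x → HasDerivAt φ (x ^ β) x := by
    intro x hx
    have := (Real.hasDerivAt_rpow_const (p := β + 1) (Or.inl hx.ne')).div_const (β + 1)
    rwa [add_sub_cancel_right, mul_div_cancel_left₀ _ hβ1.ne'] at this
  obtain ⟨M, hM⟩ : ∃ M : NNReal, ∀ x ∈ Icc ε r, ‖x ^ β‖₊ ≤ M := by
    have hc : ContinuousOn (fun x : ℝ => x ^ β) (Icc ε r) :=
      continuousOn_id.rpow_const fun x hx => Or.inl (hε.trans_le hx.1).ne'
    obtain ⟨M, hM⟩ := isCompact_Icc.exists_bound_of_continuousOn hc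
    refine ⟨M.toNNReal, fun x hx => ?_⟩
    rw [← NNReal.coe_le_coe, coe_nnnorm]
    exact (hM x hx).trans (Real.le_coe_toNNReal M)
  have hφL : LipschitzOnWith M φ (Icc ε r) :=
    (convex_Icc ε r).lipschitzOnWith_of_nnnorm_hasDerivWithin_le
      (fun x hx => (hφd x (hε.trans_le hx.1)).hasDerivWithinAt) hM
  have hHL : LipschitzOnWith (M * K) (φ ∘ u) (Icc 0 1) := hφL.comp huL huI
  have hftc := (LipschitzOnWith.absolutelyContinuousOnInterval (f := φ ∘ u) (a := 0) (b := 1)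
    (by rwa [uIcc_of_le zero_le_one])).integral_deriv_eq_sub
  have hu1 : u 1 = r := by simp [hu, h1, hεr.le]
  have hu0 : u 0 = ε := by simp [hu, h0, hε.le]
  have hendpts : (φ ∘ u) 1 - (φ ∘ u) 0 = r ^ (β + 1) / (β + 1) - ε ^ (β + 1) / (β + 1) := by
    simp [hu1, hu0, hφ]
  rw [← hendpts, ← hftc, intervalIntegral.integral_of_le zero_le_one,
    setLIntegral_congr Ioo_ae_eq_Icc.symm, integral_Ioc_eq_integral_Ioo]
  refine (Real.ofReal_le_enorm _).trans
    ((enorm_integral_le_lintegral_enorm (deriv (φ ∘ u))).trans (lintegral_mono_ae ?_))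
  have hdγ := hγ.ae_differentiableWithinAt_of_mem_real
  have hdu' := huL.ae_differentiableWithinAt_of_mem_real
  filter_upwards [ae_restrict_mem measurableSet_Ioo, ae_restrict_of_ae hdγ,
    ae_restrict_of_ae hdu'] with t ht ht1 ht2
  have hnh : Icc (0 : ℝ) 1 ∈ nhds t := Icc_mem_nhds ht.1 ht.2
  have htI : t ∈ Icc (0 : ℝ) 1 := ⟨ht.1.le, ht.2.le⟩
  have hγt := (ht1 htI).differentiableAt hnh
  have hut := (ht2 htI).differentiableAt hnh
  have hupos : 0 < u t := hε.trans_le (huI t htI).1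
  have hder : deriv (φ ∘ u) t = u t ^ β * deriv u t :=
    ((hφd _ hupos).comp t hut.hasDerivAt).deriv
  rw [hder, enorm_mul]
  rcases lt_or_ge (dist (γ t) z₀) ε with hlt | hge
  · have hconst : u =ᶠ[nhds t] fun _ => ε := by
      have hcont : ContinuousAt (fun s => dist (γ s) z₀) t :=
        hγt.continuousAt.dist continuousAt_const
      filter_upwards [hcont.eventually_lt continuousAt_const hlt] with s hs
      exact max_eq_left hs.le
    rw [hconst.deriv_eq]
    simp
  · have hut' : u t = dist (γ t) z₀ := max_eq_right hge
    rw [hut'] at hupos ⊢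
    rw [Real.enorm_of_nonneg (by positivity), ENNReal.ofReal_rpow_of_pos hupos]
    gcongr
    rw [enorm_le_iff_norm_le]
    exact norm_deriv_le_of_dist_le (fun s => hdu s t) hγt

lemma ofReal_le_lintegral_rpow {β : ℝ} (hβ : -1 < β) {z₀ : ℂ} {r : ℝ} (hr : 0 < r)
    {γ : ℝ → ℂ} {K : NNReal} (hγ : LipschitzOnWith K γ (Icc 0 1))
    (hB : ∀ t ∈ Icc (0 : ℝ) 1, γ t ∈ closedBall z₀ r) (h0 : γ 0 = z₀) (h1 : dist (γ 1) z₀ = r) :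
    ENNReal.ofReal (r ^ (β + 1) / (β + 1)) ≤
      ∫⁻ t in Icc (0 : ℝ) 1, ENNReal.ofReal (dist (γ t) z₀) ^ β * ‖deriv γ t‖ₑ := by
  have hβ1 : 0 < β + 1 := by linarith
  have hlim : Filter.Tendsto (fun ε : ℝ => ENNReal.ofReal
      (r ^ (β + 1) / (β + 1) - ε ^ (β + 1) / (β + 1))) (nhdsWithin 0 (Ioi 0))
      (nhds (ENNReal.ofReal (r ^ (β + 1) / (β + 1)))) := by
    have hc : Continuous fun ε : ℝ => ENNReal.ofReal
        (r ^ (β + 1) / (β + 1) - ε ^ (β + 1) / (β + 1)) :=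
      ENNReal.continuous_ofReal.comp
        (continuous_const.sub ((Real.continuous_rpow_const hβ1.le).div_const _))
    have := hc.tendsto 0
    rw [Real.zero_rpow hβ1.ne', zero_div, sub_zero] at this
    exact this.mono_left nhdsWithin_le_nhds
  refine le_of_tendsto hlim ?_
  filter_upwards [Ioo_mem_nhdsGT hr] with ε hε
  exact ofReal_sub_le_lintegral_rpow hβ hε.1 hε.2 hγ hB h0 h1

/-- The power density `z ↦ |z - z₀| ^ β` on `B(z₀, r)`, normalized to have integral `1` along
every radius. -/
def radialDensity (z₀ : ℂ) (r β : ℝ) : ℂ → ℝ≥0∞ :=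
  (closedBall z₀ r).indicator fun z =>
    ENNReal.ofReal ((β + 1) / r ^ (β + 1)) * ENNReal.ofReal (dist z z₀) ^ β

lemma measurable_radialDensity (z₀ : ℂ) (r β : ℝ) : Measurable (radialDensity z₀ r β) :=
  Measurable.indicator (by fun_prop) measurableSet_closedBall

lemma isAdmissible_radialDensity {β : ℝ} (hβ : -1 < β) (z₀ : ℂ) {r : ℝ} (hr : 0 < r) :
    IsAdmissible (radialDensity z₀ r β) (radialCurves z₀ r) := by
  refine ⟨measurable_radialDensity z₀ r β, fun γ ⟨_, hB, h0, h1⟩ => ?_⟩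
  have hβ1 : 0 < β + 1 := by linarith
  rw [lineIntegral]
  split_ifs with hL
  · obtain ⟨K, hK⟩ := hL
    have hle := ofReal_le_lintegral_rpow hβ hr hK hB h0 h1
    calc (1 : ℝ≥0∞) = ENNReal.ofReal ((β + 1) / r ^ (β + 1)) *
          ENNReal.ofReal (r ^ (β + 1) / (β + 1)) := by
          have := Real.rpow_pos_of_pos hr (β + 1)
          rw [← ENNReal.ofReal_mul (by positivity), ← ENNReal.ofReal_one]
          congr 1
          field_simp
      _ ≤ _ := mul_le_mul_right hle _
      _ = _ := by
          rw [← lintegral_const_mul' _ _ ENNReal.ofReal_ne_top]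
          refine setLIntegral_congr_fun measurableSet_Icc fun t ht => ?_
          rw [radialDensity, indicator_of_mem (hB t ht), mul_assoc, enorm_eq_nnnorm]
  · exact le_top

lemma closedBall_subset_of_lt_infDist_frontier {D : Set ℂ} (hD : IsOpen D) {z₀ : ℂ} (hz : z₀ ∈ D)
    {r : ℝ} (hr0 : 0 < r) (hr : r < infDist z₀ (frontier D)) : closedBall z₀ r ⊆ D := by
  have hdisj : Disjoint (closedBall z₀ r) (frontier D) := disjoint_closedBall_of_lt_infDist hr
  have hconn : IsPreconnected (closedBall z₀ r) := (convex_closedBall z₀ r).isPreconnected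
  refine hconn.subset_left_of_subset_union hD isClosed_closure.isOpen_compl
    (disjoint_compl_right.mono_left subset_closure) (fun z hz' => ?_)
    ⟨z₀, mem_closedBall_self hr0.le, hz⟩
  by_contra hcon
  simp only [mem_union, mem_compl_iff, not_or, not_not] at hcon
  refine hdisj.notMem_of_mem_left hz' ⟨hcon.2, ?_⟩
  rw [hD.interior_eq]
  exact hcon.1

lemma circleMean_mul_radialDensity_rpow {p : ℝ} (hp : 0 < p) (Q : ℂ → ℝ≥0∞) (z₀ : ℂ)
    {r β t : ℝ} (ht : 0 < t) (hβ : 0 < β + 1) (hr : 0 < r) :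
    circleMean (fun z => Q z * radialDensity z₀ r β z ^ p) z₀ t = if t ≤ r then
      ENNReal.ofReal (((β + 1) / r ^ (β + 1)) ^ p * t ^ (β * p)) * circleMean Q z₀ t else 0 := by
  have hdist : ∀ θ : ℝ, dist (z₀ + (t : ℂ) * Complex.exp ((θ : ℂ) * Complex.I)) z₀ = t := by
    intro θ
    rw [dist_eq_norm, add_sub_cancel_left, norm_mul, Complex.norm_exp_ofReal_mul_I,
      Complex.norm_real, mul_one, Real.norm_of_nonneg ht.le]
  have hc := Real.rpow_pos_of_pos hr (β + 1)
  simp only [circleMean]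
  split_ifs with htr
  · have : ∀ θ : ℝ, radialDensity z₀ r β
        (z₀ + (t : ℂ) * Complex.exp ((θ : ℂ) * Complex.I)) ^ p =
        ENNReal.ofReal (((β + 1) / r ^ (β + 1)) ^ p * t ^ (β * p)) := by
      intro θ
      rw [radialDensity, indicator_of_mem (mem_closedBall.2 ((hdist θ).trans_le htr)), hdist,
        ENNReal.mul_rpow_of_nonneg _ _ hp.le, ← ENNReal.rpow_mul,
        ENNReal.ofReal_rpow_of_pos (by positivity), ENNReal.ofReal_rpow_of_pos ht,
        ← ENNReal.ofReal_mul (by positivity)]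
    simp only [this]
    rw [lintegral_mul_const' _ _ ENNReal.ofReal_ne_top, mul_comm, mul_div_assoc]
  · have : ∀ θ : ℝ, radialDensity z₀ r β
        (z₀ + (t : ℂ) * Complex.exp ((θ : ℂ) * Complex.I)) = 0 := by
      intro θ
      rw [radialDensity, indicator_of_notMem]
      rw [mem_closedBall, hdist]
      exact htr
    simp [this, ENNReal.zero_rpow_of_pos hp]

lemma lintegral_mul_radialDensity_rpow_le {p : ℝ} (hp : 2 < p) {Q : ℂ → ℝ≥0∞} (hQ : Measurable Q)
    {z₀ : ℂ} {r q₀ α β : ℝ} (hr : 0 < r) (hq₀ : 0 < q₀) (hβ : -1 < β)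
    (hαβ : 1 + β * p - α = β)
    (hq : ∀ᵐ t ∂(volume.restrict (Ioo (0 : ℝ) r)),
      circleMean Q z₀ t ≤ ENNReal.ofReal (q₀ * t ^ (-α))) :
    ∫⁻ z, Q z * radialDensity z₀ r β z ^ p ≤
      ENNReal.ofReal (2 * Real.pi * q₀ * ((β + 1) / r ^ (β + 1)) ^ (p - 1)) := by
  have hβ1 : 0 < β + 1 := by linarith
  have hrβ := Real.rpow_pos_of_pos hr (β + 1)
  set c : ℝ := (β + 1) / r ^ (β + 1) with hc
  have hc0 : 0 < c := by positivity
  have hπ := Real.pi_pos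
  rw [lintegral_eq_lintegral_circleMean (F := fun z => Q z * radialDensity z₀ r β z ^ p)
    (hQ.mul ((measurable_radialDensity z₀ r β).pow_const p)) z₀]
  calc
    _ = ∫⁻ t in Ioi (0 : ℝ), (Iic r).indicator (fun t => ENNReal.ofReal (2 * Real.pi * t) *
          (ENNReal.ofReal (c ^ p * t ^ (β * p)) * circleMean Q z₀ t)) t := by
        refine setLIntegral_congr_fun measurableSet_Ioi fun t ht => ?_
        rw [circleMean_mul_radialDensity_rpow (by linarith) Q z₀ ht hβ1 hr, indicator_apply]
        simp only [mem_Iic, mul_ite, mul_zero, hc]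
    _ = ∫⁻ t in Ioo 0 r, ENNReal.ofReal (2 * Real.pi * t) *
          (ENNReal.ofReal (c ^ p * t ^ (β * p)) * circleMean Q z₀ t) := by
        rw [setLIntegral_indicator measurableSet_Iic, inter_comm, Ioi_inter_Iic,
          setLIntegral_congr Ioo_ae_eq_Ioc.symm]
    _ ≤ ∫⁻ t in Ioo 0 r, ENNReal.ofReal (2 * Real.pi * q₀ * c ^ p) * ENNReal.ofReal t ^ β := by
        refine lintegral_mono_ae ?_
        filter_upwards [hq, ae_restrict_mem measurableSet_Ioo] with t hqt ht
        have ht0 : 0 < t := ht.1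
        refine (mul_le_mul_right (mul_le_mul_right hqt _) _).trans (le_of_eq ?_)
        rw [ENNReal.ofReal_rpow_of_pos ht0, ← ENNReal.ofReal_mul (by positivity),
          ← ENNReal.ofReal_mul (by positivity), ← ENNReal.ofReal_mul (by positivity)]
        congr 1
        have : t ^ β = t * t ^ (β * p) * t ^ (-α) := by
          conv_lhs => rw [← hαβ, sub_eq_add_neg, Real.rpow_add ht0, Real.rpow_add ht0,
            Real.rpow_one]
        rw [this]
        ring
    _ = _ := by
        rw [lintegral_const_mul' _ _ ENNReal.ofReal_ne_top, lintegral_Ioo_rpow hβ hr.le,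
          ← ENNReal.ofReal_mul (by positivity), show r ^ (β + 1) / (β + 1) = c⁻¹ by simp [hc],
          Real.rpow_sub_one hc0.ne']
        congr 1
        ring

lemma area_bound_rpow_mul_eq {p α q₀ r β : ℝ} (hp : 2 < p) (hα : 0 ≤ α) (hq₀ : 0 < q₀)
    (hr : 0 < r) (hβ : β + 1 = (α + p - 2) / (p - 1)) :
    (Real.pi ^ (-(α / (p - 2))) * ((p - 2) / (α + p - 2)) ^ (2 * (p - 1) / (p - 2)) *
        q₀ ^ (2 / (2 - p)) * (r ^ 2 * Real.pi) ^ (1 + α / (p - 2))) ^ ((p - 2) / 2) *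
      (((p - 1) / (p - 2)) ^ (p - 1) *
        (2 * Real.pi * q₀ * ((β + 1) / r ^ (β + 1)) ^ (p - 1)) * 2 ^ ((p - 2) / 2)) =
      (2 * Real.pi) ^ (p / 2) := by
  have h1 : 0 < p - 1 := by linarith
  have h2 : 0 < p - 2 := by linarith
  have h2' : 2 - p ≠ 0 := by linarith
  have h3 : 0 < α + p - 2 := by linarith
  have hπ := Real.pi_pos
  rw [hβ]
  refine Real.log_injOn_pos (mem_Ioi.2 (by positivity)) (mem_Ioi.2 (by positivity)) ?_
  have e : 2 / (2 - p) = -(2 / (p - 2)) := by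
    rw [← neg_sub p 2, div_neg]
  have L1 : ∀ x y : ℝ, 0 < x → 0 < y → Real.log (x * y) = Real.log x + Real.log y :=
    fun x y hx hy => Real.log_mul hx.ne' hy.ne'
  have L2 : ∀ x y : ℝ, 0 < x → 0 < y → Real.log (x / y) = Real.log x - Real.log y :=
    fun x y hx hy => Real.log_div hx.ne' hy.ne'
  have L3 : ∀ x y : ℝ, 0 < x → Real.log (x ^ y) = y * Real.log x :=
    fun x y hx => Real.log_rpow hx y
  rw [e]
  simp (disch := positivity) only [L1, L2, L3, Real.log_pow]
  push_cast
  field_simp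
  ring

/-- **Corollary 1.** If `q_{z₀}(t) ≤ q₀ t^{-α}` for a.e. `t ∈ (0, d₀)`, then for all
`r ∈ (0, d₀)`,
`|fB(z₀,r)| ≥ π^{-α/(p-2)} ((p-2)/(α+p-2))^{2(p-1)/(p-2)} q₀^{2/(2-p)} |B(z₀,r)|^{1+α/(p-2)}`. -/
theorem area_image_disc_lower_bound_power
    (p : ℝ) (hp : 2 < p) (D D' : Set ℂ)
    (hDo : IsOpen D) (hDc : IsConnected D) (hDb : Bornology.IsBounded D)
    (hD'o : IsOpen D') (hD'c : IsConnected D') (hD'b : Bornology.IsBounded D')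
    (Q : ℂ → ℝ≥0∞) (hQmeas : Measurable Q)
    (f : ℂ → ℂ) (hf : IsQHomeo p D Q f) (hfD : f '' D = D')
    (z₀ : ℂ) (hz₀ : z₀ ∈ D)
    (q₀ : ℝ) (hq₀ : 0 < q₀) (α : ℝ) (hα : 0 ≤ α)
    (hq : ∀ᵐ t ∂(volume.restrict (Set.Ioo (0 : ℝ) (Metric.infDist z₀ (frontier D)))),
      circleMean Q z₀ t ≤ ENNReal.ofReal (q₀ * t ^ (-α)))
    (r : ℝ) (hr0 : 0 < r) (hr : r < Metric.infDist z₀ (frontier D)) :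
    ENNReal.ofReal (Real.pi ^ (-(α / (p - 2))) *
          ((p - 2) / (α + p - 2)) ^ (2 * (p - 1) / (p - 2)) * q₀ ^ (2 / (2 - p))) *
        volume (Metric.closedBall z₀ r) ^ (1 + α / (p - 2)) ≤
      volume (f '' Metric.closedBall z₀ r) := by
  have hp1 : 0 < p - 1 := by linarith
  have hp2 : 0 < p - 2 := by linarith
  have h3 : 0 < α + p - 2 := by linarith
  have hπ := Real.pi_pos
  have hB : closedBall z₀ r ⊆ D := closedBall_subset_of_lt_infDist_frontier hDo hz₀ hr0 hr
  obtain ⟨β, hβ⟩ : ∃ β, β + 1 = (α + p - 2) / (p - 1) := ⟨_, sub_add_cancel _ 1⟩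
  have hβ1 : 0 < β + 1 := hβ ▸ by positivity
  have hβ' : -1 < β := by linarith
  have hαβ : 1 + β * p - α = β := by
    rw [eq_div_iff hp1.ne'] at hβ
    linarith
  have hcurves : CurveFamilyIn (radialCurves z₀ r) D :=
    fun γ hγ => ⟨hγ.1, fun t ht => hB (hγ.2.1 t ht)⟩
  have hupper := (hf.2 _ hcurves _ (isAdmissible_radialDensity hβ' z₀ hr0)).trans
    ((setLIntegral_le_lintegral D _).trans (lintegral_mul_radialDensity_rpow_le hp hQmeas hr0 hq₀
      hβ' hαβ (ae_restrict_of_ae_restrict_of_subset (Ioo_subset_Ioo_right hr.le) hq)))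
  have hmain := rpow_two_pi_le_pModulus_mul_volume hp hf.1 hDo hr0 hB
  set V := volume (f '' closedBall z₀ r) with hV
  have hVtop : V ≠ ⊤ :=
    ((isCompact_closedBall z₀ r).image_of_continuousOn (hf.1.1.mono hB)).measure_lt_top.ne
  have hbound := hmain.trans (mul_le_mul' (mul_le_mul_right hupper _)
    (ENNReal.rpow_le_rpow (mul_le_mul_right
      (measure_mono (μ := volume) (image_mono (f := f) (ball_subset_closedBall (x := z₀) (ε := r))))
      2) (by positivity)))
  have h2V : (2 * V) ^ ((p - 2) / 2) =
      ENNReal.ofReal (2 ^ ((p - 2) / 2) * V.toReal ^ ((p - 2) / 2)) := by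
    rw [← Real.mul_rpow (by norm_num) ENNReal.toReal_nonneg,
      ← ENNReal.ofReal_rpow_of_nonneg (by positivity) (by positivity),
      ENNReal.ofReal_mul (by norm_num), ENNReal.ofReal_toReal hVtop, ENNReal.ofReal_ofNat]
  have hC : 0 < ((p - 1) / (p - 2)) ^ (p - 1) := by positivity
  rw [← hV, h2V, ENNReal.ofReal_rpow_of_pos (by positivity), ← ENNReal.ofReal_mul hC.le,
    ← ENNReal.ofReal_mul (by positivity), ENNReal.ofReal_le_ofReal_iff (by positivity),
    ← mul_assoc, ← area_bound_rpow_mul_eq hp hα hq₀ hr0 hβ, mul_comm] at hbound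
  have hball : volume (closedBall z₀ r) = ENNReal.ofReal (r ^ 2 * Real.pi) := by
    rw [Complex.volume_closedBall, ENNReal.ofReal_mul (by positivity),
      ENNReal.ofReal_pow hr0.le, ← NNReal.coe_real_pi, ENNReal.ofReal_coe_nnreal]
  rw [hball, ENNReal.ofReal_rpow_of_pos (by positivity), ← ENNReal.ofReal_mul (by positivity),
    ← ENNReal.ofReal_toReal hVtop]
  refine ENNReal.ofReal_le_ofReal ?_
  refine (Real.rpow_le_rpow_iff (z := (p - 2) / 2) (by positivity) ENNReal.toReal_nonneg
    (by positivity)).1 ?_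
  refine le_of_mul_le_mul_left hbound ?_
  positivity
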